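/- Let k and n be integers with 1 ≤ k < n. Then n^k ≤ k^{k/2} · (k+1)^{(k−1)/2} · (n choose k); equivalently, (n/k)^{k/2} · n^{k/2} ≤ (n choose k) · (k+1)^{(k−1)/2}. -/

import Mathlib

theorem bern_aux (n k : ℕ) :
    ((n : ℝ) + 1) ^ (k + 1) ≤ (n : ℝ) ^ k * (n + 1) + k * ((n : ℝ) + 1) ^ k := by
  induction k with
  | zero => simp
  | succ k ih =>
    have h0 : (0 : ℝ) ≤ (n : ℝ) + 1 := by positivity
    have h1 := mul_le_mul_of_nonneg_left ih h0
    have h2 : (n : ℝ) ^ k ≤ ((n : ℝ) + 1) ^ k :=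
      pow_le_pow_left₀ (by positivity) (by linarith) k
    have h3 := mul_le_mul_of_nonneg_right h2 h0
    push_cast
    simp only [pow_succ] at *
    nlinarith

theorem pow_aux (m : ℕ) : ((m : ℝ) + 2) ^ m ≤ ((m : ℝ) + 1) ^ (m + 1) := by
  have h := bern_aux (m + 1) m
  push_cast at h
  have e : (m : ℝ) + 1 + 1 = m + 2 := by ring
  rw [e, pow_succ] at h
  have hp : (0 : ℝ) ≤ ((m : ℝ) + 1) ^ m * m := by positivity
  rw [pow_succ]
  nlinarith

theorem main_aux (k n : ℕ) (h : k + 1 ≤ n) :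
    (n : ℝ) ^ k * (k + 1) ≤ ((k : ℝ) + 1) ^ k * (n.choose k : ℝ) := by
  induction n, h using Nat.le_induction with
  | base => simp
  | succ n hn ih =>
    have hc : ((n + 1).choose k : ℝ) * ((n : ℝ) + 1 - k) = (n.choose k : ℝ) * (n + 1) := by
      have := Nat.choose_mul_succ_eq n k
      have h2 : ((n + 1 - k : ℕ) : ℝ) = (n : ℝ) + 1 - k := by
        rw [Nat.cast_sub (by omega)]; push_cast; ring
      rw [← h2]
      exact_mod_cast this.symm
    have hb := bern_aux n k
    have hd : (0 : ℝ) < (n : ℝ) + 1 - k := by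
      have : ((k + 1 : ℕ) : ℝ) ≤ n := by exact_mod_cast hn
      push_cast at this; linarith
    push_cast
    refine le_of_mul_le_mul_right ?_ hd
    rw [mul_assoc (((k : ℝ) + 1) ^ k), hc]
    calc ((n : ℝ) + 1) ^ k * (k + 1) * ((n : ℝ) + 1 - k)
        = (((n : ℝ) + 1) ^ (k + 1) - k * ((n : ℝ) + 1) ^ k) * (k + 1) := by ring
      _ ≤ ((n : ℝ) ^ k * (n + 1)) * (k + 1) := by
          apply mul_le_mul_of_nonneg_right _ (by positivity); linarith
      _ = ((n : ℝ) ^ k * (k + 1)) * (n + 1) := by ring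
      _ ≤ (((k : ℝ) + 1) ^ k * (n.choose k : ℝ)) * (n + 1) :=
          mul_le_mul_of_nonneg_right ih (by positivity)
      _ = _ := by ring

/-- For `1 ≤ k < n`: `n^k ≤ k^(k/2) · (k+1)^((k-1)/2) · (n choose k)`; equivalently
`(n/k)^(k/2) · n^(k/2) ≤ (n choose k) · (k+1)^((k-1)/2)`. -/
theorem stmt19 (n k : ℕ) (hk : 1 ≤ k) (hkn : k < n) :
    (n : ℝ) ^ k ≤
        (k : ℝ) ^ ((k : ℝ) / 2) * ((k : ℝ) + 1) ^ (((k : ℝ) - 1) / 2) * (n.choose k : ℝ) ∧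
      ((n : ℝ) / k) ^ ((k : ℝ) / 2) * (n : ℝ) ^ ((k : ℝ) / 2) ≤
        (n.choose k : ℝ) * ((k : ℝ) + 1) ^ (((k : ℝ) - 1) / 2) := by
  have hk0 : (0 : ℝ) < k := by exact_mod_cast hk
  have hn0 : (0 : ℝ) < n := by exact_mod_cast (by omega : 0 < n)
  have first : (n : ℝ) ^ k ≤
      (k : ℝ) ^ ((k : ℝ) / 2) * ((k : ℝ) + 1) ^ (((k : ℝ) - 1) / 2) * (n.choose k : ℝ) := by
    obtain ⟨m, rfl⟩ : ∃ m, k = m + 1 := ⟨k - 1, by omega⟩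
    have hm := main_aux (m + 1) n hkn
    have hp := pow_aux m
    push_cast at *
    have e : (m : ℝ) + 1 + 1 = m + 2 := by ring
    have e' : (m : ℝ) + 1 - 1 = m := by ring
    rw [e, pow_succ ((m : ℝ) + 2)] at hm
    rw [e, e']
    have hs : ((m : ℝ) + 2) ^ ((m : ℝ) / 2) ≤ ((m : ℝ) + 1) ^ (((m : ℝ) + 1) / 2) := by
      have h := Real.rpow_le_rpow (by positivity) hp (by norm_num : (0 : ℝ) ≤ 1 / 2)
      rw [← Real.rpow_natCast, ← Real.rpow_natCast, ← Real.rpow_mul (by positivity),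
        ← Real.rpow_mul (by positivity)] at h
      push_cast at h
      convert h using 2 <;> ring
    have hq : ((m : ℝ) + 2) ^ m = ((m : ℝ) + 2) ^ ((m : ℝ) / 2) * ((m : ℝ) + 2) ^ ((m : ℝ) / 2) := by
      rw [← Real.rpow_add (by positivity), add_halves, Real.rpow_natCast]
    have hm2 : (n : ℝ) ^ (m + 1) ≤ ((m : ℝ) + 2) ^ m * (n.choose (m + 1) : ℝ) := by
      refine le_of_mul_le_mul_right ?_ (by positivity : (0 : ℝ) < (m : ℝ) + 2)
      linarith
    refine hm2.trans ?_
    rw [hq]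
    gcongr
  refine ⟨first, ?_⟩
  have hkp : (0 : ℝ) < (k : ℝ) ^ ((k : ℝ) / 2) := by positivity
  have hnn : (n : ℝ) ^ ((k : ℝ) / 2) * (n : ℝ) ^ ((k : ℝ) / 2) = (n : ℝ) ^ k := by
    rw [← Real.rpow_add hn0, add_halves, Real.rpow_natCast]
  rw [Real.div_rpow hn0.le hk0.le, div_mul_eq_mul_div, hnn, div_le_iff₀ hkp]
  linarith
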